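/- Let n > 1 and let L be the second order cone in ℝ^n. The dual cone of Z(L) in ℝ^{n×n} (with the trace inner product ⟨X,Y⟩ = tr(XᵀY)) equals {B ∈ ℝ^{n×n} : tr(B) = 0 and −JB is symmetric positive semidefinite}, where J = diag(1,−1,…,−1). -/

import Mathlib

open Matrix

noncomputable section

/-- The second order cone in `ℝⁿ`: `{(t,u) : t ≥ ‖u‖}` (first coordinate is `t`). -/
def soc (n : ℕ) [NeZero n] : Set (Fin n → ℝ) :=
  {x | Real.sqrt (∑ i, if i = 0 then 0 else (x i) ^ 2) ≤ x 0}

/-- The boundary of the second order cone: `{(t,u) : t = ‖u‖}`. -/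
def socBd (n : ℕ) [NeZero n] : Set (Fin n → ℝ) :=
  {x | Real.sqrt (∑ i, if i = 0 then 0 else (x i) ^ 2) = x 0}

/-- `J = diag(1, -1, …, -1)`. -/
def Jmat (n : ℕ) [NeZero n] : Matrix (Fin n) (Fin n) ℝ :=
  Matrix.diagonal (fun i => if i = 0 then 1 else -1)

/-- The dual cone of a set `K ⊆ ℝⁿ`. -/
def dualCone {n : ℕ} (K : Set (Fin n → ℝ)) : Set (Fin n → ℝ) :=
  {y | ∀ x ∈ K, 0 ≤ x ⬝ᵥ y}

/-- `A` is a Z-transformation on `K`: `x ∈ K`, `y ∈ K*`, `⟨x,y⟩ = 0` imply `⟨Ax,y⟩ ≤ 0`. -/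
def IsZTransf {n : ℕ} (K : Set (Fin n → ℝ)) (A : Matrix (Fin n) (Fin n) ℝ) : Prop :=
  ∀ x ∈ K, ∀ y ∈ dualCone K, x ⬝ᵥ y = 0 → (A.mulVec x) ⬝ᵥ y ≤ 0

/-- The completely positive cone of `C`: all finite sums `∑ uᵢuᵢᵀ` with `uᵢ ∈ C`. -/
def cpCone {n : ℕ} (C : Set (Fin n → ℝ)) : Set (Matrix (Fin n) (Fin n) ℝ) :=
  {X | ∃ (m : ℕ) (u : Fin m → Fin n → ℝ), (∀ i, u i ∈ C) ∧ X = ∑ i, vecMulVec (u i) (u i)}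

/-- The copositive cone of `C`: symmetric matrices `A` with `xᵀAx ≥ 0` for all `x ∈ C`. -/
def copCone {n : ℕ} (C : Set (Fin n → ℝ)) : Set (Matrix (Fin n) (Fin n) ℝ) :=
  {A | Aᵀ = A ∧ ∀ x ∈ C, 0 ≤ x ⬝ᵥ A.mulVec x}

/-- `Ω = {(x,y) ∈ L × L : ‖x‖ = 1 = ‖y‖, ⟨x,y⟩ = 0}`. -/
def OmegaSet (n : ℕ) [NeZero n] : Set ((Fin n → ℝ) × (Fin n → ℝ)) :=
  {p | p.1 ∈ soc n ∧ p.2 ∈ soc n ∧ Real.sqrt (∑ i, p.1 i ^ 2) = 1 ∧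
       Real.sqrt (∑ i, p.2 i ^ 2) = 1 ∧ p.1 ⬝ᵥ p.2 = 0}

/-- `γ(A) = max {⟨Ax,y⟩ : (x,y) ∈ Ω}`. -/
def gammaFun (n : ℕ) [NeZero n] (A : Matrix (Fin n) (Fin n) ℝ) : ℝ :=
  sSup {r | ∃ p ∈ OmegaSet n, r = (A.mulVec p.1) ⬝ᵥ p.2}

open Finset in
theorem dotProduct_eq_add_sum_erase {n : ℕ} [NeZero n] (x y : Fin n → ℝ) :
    x ⬝ᵥ y = x 0 * y 0 + ∑ i ∈ univ.erase 0, x i * y i :=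
  (add_sum_erase univ (fun i => x i * y i) (mem_univ 0)).symm

theorem Jmat_mulVec_apply {n : ℕ} [NeZero n] (x : Fin n → ℝ) (i : Fin n) :
    (Jmat n *ᵥ x) i = if i = 0 then x i else -x i := by
  rw [Jmat, mulVec_diagonal]
  split_ifs <;> simp

theorem Jmat_transpose (n : ℕ) [NeZero n] : (Jmat n)ᵀ = Jmat n :=
  diagonal_transpose _

theorem Jmat_mul_self (n : ℕ) [NeZero n] : Jmat n * Jmat n = 1 := by
  rw [Jmat, diagonal_mul_diagonal, ← diagonal_one]
  congr 1
  ext i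
  split_ifs <;> simp

theorem dotProduct_Jmat_mulVec {n : ℕ} [NeZero n] (x y : Fin n → ℝ) :
    x ⬝ᵥ Jmat n *ᵥ y = x 0 * y 0 - ∑ i ∈ Finset.univ.erase 0, x i * y i := by
  rw [dotProduct_eq_add_sum_erase, sub_eq_add_neg, ← Finset.sum_neg_distrib]
  congr 1
  · simp [Jmat_mulVec_apply]
  · refine Finset.sum_congr rfl fun i hi => ?_
    simp [Jmat_mulVec_apply, Finset.ne_of_mem_erase hi]

theorem mem_soc_iff {n : ℕ} [NeZero n] {x : Fin n → ℝ} :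
    x ∈ soc n ↔ 0 ≤ x 0 ∧ ∑ i ∈ Finset.univ.erase 0, x i ^ 2 ≤ x 0 ^ 2 := by
  have h : (∑ i, if i = 0 then 0 else x i ^ 2) = ∑ i ∈ Finset.univ.erase 0, x i ^ 2 := by
    rw [← Finset.add_sum_erase _ _ (Finset.mem_univ (0 : Fin n)), if_pos rfl, zero_add]
    exact Finset.sum_congr rfl fun i hi => if_neg (Finset.ne_of_mem_erase hi)
  rw [soc, Set.mem_ofPred_eq, h, Real.sqrt_le_iff]

theorem Jmat_mulVec_mem_dualCone {n : ℕ} [NeZero n] {x : Fin n → ℝ} (hx : x ∈ soc n) :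
    Jmat n *ᵥ x ∈ dualCone (soc n) := by
  intro z hz
  rw [mem_soc_iff] at hx hz
  rw [dotProduct_Jmat_mulVec, sub_nonneg]
  refine le_of_sq_le_sq ?_ (mul_nonneg hz.1 hx.1)
  calc _ ≤ _ := Finset.sum_mul_sq_le_sq_mul_sq _ _ _
    _ ≤ z 0 ^ 2 * x 0 ^ 2 :=
      mul_le_mul hz.2 hx.2 (Finset.sum_nonneg fun i _ => sq_nonneg _) (sq_nonneg _)
    _ = _ := by ring

theorem dualCone_soc_subset (n : ℕ) [NeZero n] : dualCone (soc n) ⊆ soc n := by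
  intro y hy
  set S := ∑ i ∈ Finset.univ.erase 0, y i ^ 2 with hS
  have hS0 : 0 ≤ S := Finset.sum_nonneg fun i _ => sq_nonneg _
  have h0 : 0 ≤ y 0 := by
    have hz : (Pi.single 0 1 : Fin n → ℝ) ∈ soc n := by
      rw [mem_soc_iff]
      refine ⟨by simp, ?_⟩
      rw [Finset.sum_eq_zero fun i hi => by simp [Finset.ne_of_mem_erase hi]]
      positivity
    simpa using hy _ hz
  have hz : (fun i => if i = 0 then √S else -y i : Fin n → ℝ) ∈ soc n := by
    rw [mem_soc_iff]
    refine ⟨by simp, le_of_eq ?_⟩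
    rw [if_pos rfl, Real.sq_sqrt hS0, hS]
    exact Finset.sum_congr rfl fun i hi => by simp [Finset.ne_of_mem_erase hi]
  have h1 := hy _ hz
  rw [dotProduct_eq_add_sum_erase, if_pos rfl, Finset.sum_congr rfl (g := fun i => -(y i ^ 2))
    (fun i hi => by rw [if_neg (Finset.ne_of_mem_erase hi)]; ring), Finset.sum_neg_distrib,
    ← hS] at h1
  refine mem_soc_iff.2 ⟨h0, ?_⟩
  rw [← hS]
  have h2 := Real.sq_sqrt hS0
  rcases (Real.sqrt_nonneg S).eq_or_lt with h | h
  · rw [← h] at h2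
    nlinarith [sq_nonneg (y 0)]
  · have : √S ≤ y 0 := by nlinarith
    nlinarith

/-- Orthogonal vectors of the second order cone are reflections of each other, up to scaling. -/
theorem smul_eq_smul_Jmat_mulVec {n : ℕ} [NeZero n] {x y : Fin n → ℝ} (hx : x ∈ soc n)
    (hy : y ∈ soc n) (hxy : x ⬝ᵥ y = 0) : x 0 • y = y 0 • Jmat n *ᵥ x := by
  rw [mem_soc_iff] at hx hy
  rw [dotProduct_eq_add_sum_erase] at hxy
  have hsum : ∑ i ∈ Finset.univ.erase 0, (x 0 * y i + y 0 * x i) ^ 2 ≤ 0 := by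
    have : ∑ i ∈ Finset.univ.erase 0, (x 0 * y i + y 0 * x i) ^ 2 =
        x 0 ^ 2 * ∑ i ∈ Finset.univ.erase 0, y i ^ 2 +
        2 * x 0 * y 0 * ∑ i ∈ Finset.univ.erase 0, x i * y i +
        y 0 ^ 2 * ∑ i ∈ Finset.univ.erase 0, x i ^ 2 := by
      simp only [Finset.mul_sum, ← Finset.sum_add_distrib]
      exact Finset.sum_congr rfl fun i _ => by ring
    rw [this, eq_neg_of_add_eq_zero_right hxy]
    nlinarith [mul_le_mul_of_nonneg_left hx.2 (sq_nonneg (y 0)),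
      mul_le_mul_of_nonneg_left hy.2 (sq_nonneg (x 0))]
  have hzero := (Finset.sum_eq_zero_iff_of_nonneg fun i _ => sq_nonneg _).1
    (hsum.antisymm (Finset.sum_nonneg fun i _ => sq_nonneg _))
  ext i
  simp only [Pi.smul_apply, smul_eq_mul, Jmat_mulVec_apply]
  split_ifs with hi
  · rw [hi, mul_comm]
  · have := pow_eq_zero_iff two_ne_zero |>.1
      (hzero i (Finset.mem_erase.2 ⟨hi, Finset.mem_univ i⟩))
    linarith

theorem eq_zero_of_mem_soc {n : ℕ} [NeZero n] {x : Fin n → ℝ} (hx : x ∈ soc n)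
    (h0 : x 0 = 0) : x = 0 := by
  rw [mem_soc_iff, h0, zero_pow two_ne_zero] at hx
  have hzero := (Finset.sum_eq_zero_iff_of_nonneg fun i _ => sq_nonneg _).1
    (hx.2.antisymm (Finset.sum_nonneg fun i _ => sq_nonneg _))
  ext i
  by_cases hi : i = 0
  · rw [hi, h0, Pi.zero_apply]
  · exact pow_eq_zero_iff two_ne_zero |>.1
      (hzero i (Finset.mem_erase.2 ⟨hi, Finset.mem_univ i⟩))

theorem mulVec_dotProduct_Jmat_mulVec {n : ℕ} [NeZero n] (A : Matrix (Fin n) (Fin n) ℝ)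
    (x : Fin n → ℝ) : A *ᵥ x ⬝ᵥ Jmat n *ᵥ x = x ⬝ᵥ (Jmat n * A) *ᵥ x := by
  rw [← mulVec_mulVec, dotProduct_mulVec, dotProduct_comm, ← mulVec_transpose, Jmat_transpose]

/-- `A` is a Z-transformation on the second order cone iff the quadratic form of `J * A` is
nonpositive on the isotropic vectors of `J`. -/
theorem isZTransf_soc_iff {n : ℕ} [NeZero n] {A : Matrix (Fin n) (Fin n) ℝ} :
    IsZTransf (soc n) A ↔
      ∀ x : Fin n → ℝ, x ⬝ᵥ Jmat n *ᵥ x = 0 → x ⬝ᵥ (Jmat n * A) *ᵥ x ≤ 0 := by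
  constructor
  · intro hA x hx
    wlog h0 : 0 ≤ x 0 generalizing x
    · simpa [mulVec_neg] using
        this (-x) (by simpa [mulVec_neg] using hx) (by simpa using (not_le.1 h0).le)
    have hmem : x ∈ soc n := by
      rw [dotProduct_Jmat_mulVec] at hx
      refine mem_soc_iff.2 ⟨h0, ?_⟩
      simp only [pow_two]
      linarith
    rw [← mulVec_dotProduct_Jmat_mulVec]
    exact hA x hmem _ (Jmat_mulVec_mem_dualCone hmem) hx
  · intro hA x hx y hy hxy
    have hy' := dualCone_soc_subset n hy
    have h := smul_eq_smul_Jmat_mulVec hx hy' hxy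
    rcases (mem_soc_iff.1 hx).1.eq_or_lt with hx0 | hx0
    · simp [eq_zero_of_mem_soc hx hx0.symm]
    rcases (mem_soc_iff.1 hy').1.eq_or_lt with hy0 | hy0
    · simp [eq_zero_of_mem_soc hy' hy0.symm]
    have hq : x ⬝ᵥ Jmat n *ᵥ x = 0 := by
      have := congrArg (x ⬝ᵥ ·) h
      simp only [dotProduct_smul, hxy, smul_eq_mul, mul_zero] at this
      exact (mul_eq_zero.1 this.symm).resolve_left hy0.ne'
    have hA' := hA x hq
    have := congrArg (A *ᵥ x ⬝ᵥ ·) h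
    simp only [dotProduct_smul, smul_eq_mul, mulVec_dotProduct_Jmat_mulVec] at this
    exact nonpos_of_mul_nonpos_right
      (this.trans_le (mul_nonpos_of_nonneg_of_nonpos hy0.le hA')) hx0

theorem quadratic_rotation {n : ℕ} (M : Matrix (Fin n) (Fin n) ℝ) (x y : Fin n → ℝ) (θ : ℝ) :
    (Real.cos θ • x + Real.sin θ • y) ⬝ᵥ M *ᵥ (Real.cos θ • x + Real.sin θ • y) +
      (Real.sin θ • x - Real.cos θ • y) ⬝ᵥ M *ᵥ (Real.sin θ • x - Real.cos θ • y) =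
      x ⬝ᵥ M *ᵥ x + y ⬝ᵥ M *ᵥ y := by
  simp only [mulVec_add, mulVec_sub, mulVec_smul, add_dotProduct, sub_dotProduct, dotProduct_add,
    dotProduct_sub, smul_dotProduct, dotProduct_smul, smul_eq_mul]
  linear_combination (x ⬝ᵥ M *ᵥ x + y ⬝ᵥ M *ᵥ y) * Real.sin_sq_add_cos_sq θ

theorem exists_rotation_isotropic {n : ℕ} (Q : Matrix (Fin n) (Fin n) ℝ) {x y : Fin n → ℝ}
    (hx : 0 ≤ x ⬝ᵥ Q *ᵥ x) (hy : y ⬝ᵥ Q *ᵥ y ≤ 0) :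
    ∃ θ : ℝ, (Real.cos θ • x + Real.sin θ • y) ⬝ᵥ
      Q *ᵥ (Real.cos θ • x + Real.sin θ • y) = 0 := by
  have hcont : Continuous fun θ : ℝ => (Real.cos θ • x + Real.sin θ • y) ⬝ᵥ
      Q *ᵥ (Real.cos θ • x + Real.sin θ • y) := by
    simp only [mulVec_add, mulVec_smul, add_dotProduct, dotProduct_add,
      smul_dotProduct, dotProduct_smul, smul_eq_mul]
    fun_prop
  refine mem_range_of_exists_le_of_exists_ge hcont ⟨Real.pi / 2, ?_⟩ ⟨0, ?_⟩
  · simpa using hy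
  · simpa using hx

/-- If the quadratic form of `M` is nonpositive on the isotropic vectors of `Q`, then its sum is
nonpositive over any finite family on which the form of `Q` sums to zero. -/
theorem sum_quadratic_nonpos {n : ℕ} {ι : Type*} [DecidableEq ι]
    (Q M : Matrix (Fin n) (Fin n) ℝ)
    (h : ∀ x : Fin n → ℝ, x ⬝ᵥ Q *ᵥ x = 0 → x ⬝ᵥ M *ᵥ x ≤ 0) (s : Finset ι)
    (p : ι → Fin n → ℝ) (hp : ∑ i ∈ s, p i ⬝ᵥ Q *ᵥ p i = 0) :
    ∑ i ∈ s, p i ⬝ᵥ M *ᵥ p i ≤ 0 := by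
  induction hm : s.card generalizing s p with
  | zero => simp [Finset.card_eq_zero.1 hm]
  | succ m ih =>
    by_cases hall : ∀ i ∈ s, p i ⬝ᵥ Q *ᵥ p i = 0
    · exact Finset.sum_nonpos fun i hi => h _ (hall i hi)
    push Not at hall
    obtain ⟨k, hk, hk0⟩ := hall
    obtain ⟨i, hi, hi0⟩ := Finset.exists_pos_of_sum_zero_of_exists_nonzero _ hp ⟨k, hk, hk0⟩
    obtain ⟨j, hj, hj0⟩ : ∃ j ∈ s, p j ⬝ᵥ Q *ᵥ p j < 0 := by
      by_contra! hc
      exact hk0 ((Finset.sum_eq_zero_iff_of_nonneg hc).1 hp k hk)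
    have hij : j ≠ i := by
      rintro rfl
      exact lt_asymm hi0 hj0
    have hj' : j ∈ s.erase i := Finset.mem_erase.2 ⟨hij, hj⟩
    obtain ⟨θ, hθ⟩ := exists_rotation_isotropic Q hi0.le hj0.le
    set p' := Function.update p j (Real.sin θ • p i - Real.cos θ • p j) with hp'
    have hsum : ∀ N : Matrix (Fin n) (Fin n) ℝ, ∑ l ∈ s, p l ⬝ᵥ N *ᵥ p l =
        (Real.cos θ • p i + Real.sin θ • p j) ⬝ᵥ N *ᵥ (Real.cos θ • p i + Real.sin θ • p j) +
        ∑ l ∈ s.erase i, p' l ⬝ᵥ N *ᵥ p' l := by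
      intro N
      have hrest : ∑ l ∈ (s.erase i).erase j, p' l ⬝ᵥ N *ᵥ p' l =
          ∑ l ∈ (s.erase i).erase j, p l ⬝ᵥ N *ᵥ p l :=
        Finset.sum_congr rfl fun l hl => by
          rw [hp', Function.update_of_ne (Finset.ne_of_mem_erase hl)]
      rw [← Finset.add_sum_erase s _ hi, ← Finset.add_sum_erase _ _ hj',
        ← Finset.add_sum_erase _ (fun l => p' l ⬝ᵥ N *ᵥ p' l) hj', hrest]
      simp only [hp', Function.update_self]
      linarith [quadratic_rotation N (p i) (p j) θ]
    rw [hsum M]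
    refine add_nonpos (h _ hθ) (ih _ _ ?_ ?_)
    · rw [hsum Q, hθ, zero_add] at hp
      exact hp
    · rw [Finset.card_erase_of_mem hi, hm, Nat.add_sub_cancel]

theorem trace_transpose_mul_self_mul {n : ℕ} (C M : Matrix (Fin n) (Fin n) ℝ) :
    (Cᵀ * C * M).trace = ∑ i, C i ⬝ᵥ M *ᵥ C i := by
  rw [Matrix.mul_assoc, trace_mul_comm, Matrix.mul_assoc]
  rfl

theorem trace_mul_vecMulVec {n : ℕ} (M : Matrix (Fin n) (Fin n) ℝ) (u v : Fin n → ℝ) :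
    (M * vecMulVec u v).trace = v ⬝ᵥ M *ᵥ u := by
  rw [mul_vecMulVec, trace_vecMulVec, dotProduct_comm]

open scoped MatrixOrder in
theorem exists_eq_transpose_mul_self {n : ℕ} {P : Matrix (Fin n) (Fin n) ℝ}
    (hP : P.PosSemidef) : ∃ C : Matrix (Fin n) (Fin n) ℝ, P = Cᵀ * C := by
  obtain ⟨C, hC⟩ := CStarAlgebra.nonneg_iff_eq_star_mul_self.1 hP.nonneg
  exact ⟨C, by rw [hC, star_eq_conjTranspose, conjTranspose_eq_transpose_of_trivial]⟩

theorem stmt3 (n : ℕ) [NeZero n] (hn : 1 < n) :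
    {B : Matrix (Fin n) (Fin n) ℝ | ∀ A, IsZTransf (soc n) A → 0 ≤ (Bᵀ * A).trace} =
      {B : Matrix (Fin n) (Fin n) ℝ | B.trace = 0 ∧ (-(Jmat n * B)).PosSemidef} := by
  ext B
  simp only [Set.mem_ofPred_eq, isZTransf_soc_iff]
  constructor
  · intro hB
    have hJ : ∀ S, Jmat n * (Jmat n * S) = S := fun S => by
      rw [← Matrix.mul_assoc, Jmat_mul_self, Matrix.one_mul]
    have hBJ : ∀ S, Bᵀ * (Jmat n * S) = (Jmat n * B)ᵀ * S := fun S => by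
      rw [transpose_mul, Jmat_transpose, Matrix.mul_assoc]
    have hquad : ∀ S : Matrix (Fin n) (Fin n) ℝ, (∀ x, x ⬝ᵥ S *ᵥ x ≤ 0) →
        0 ≤ ((Jmat n * B)ᵀ * S).trace := fun S hS => by
      rw [← hBJ]
      exact hB _ fun x _ => by rw [hJ]; exact hS x
    refine ⟨le_antisymm ?_ ?_, ?_⟩
    · simpa using hB (-1) fun x hx => by simp [neg_mulVec, hx]
    · simpa using hB 1 fun x hx => by simp [hx]
    · have hsymm : (Jmat n * B)ᵀ = Jmat n * B := by
        ext i j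
        have hskew : ∀ i j, (Jmat n * B) j i ≤ (Jmat n * B) i j := by
          intro i j
          have := hquad (vecMulVec (Pi.single i 1) (Pi.single j 1) -
            vecMulVec (Pi.single j 1) (Pi.single i 1)) fun x => by
              simp [sub_mulVec, vecMulVec_mulVec, mul_comm]
          rw [Matrix.mul_sub, trace_sub, trace_mul_vecMulVec, trace_mul_vecMulVec] at this
          simpa only [transpose_apply, mulVec_single_one, single_one_dotProduct,
            sub_nonneg, col_apply] using this
        exact le_antisymm (hskew i j) (hskew j i)
      refine PosSemidef.of_dotProduct_mulVec_nonneg ?_ fun x => ?_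
      · rw [IsHermitian, conjTranspose_eq_transpose_of_trivial, transpose_neg, hsymm]
      · have := hquad (-vecMulVec x x) fun y => by
          simp [neg_mulVec, vecMulVec_mulVec, dotProduct_comm y x, mul_self_nonneg]
        rw [Matrix.mul_neg, trace_neg, trace_mul_vecMulVec, hsymm] at this
        simpa [neg_mulVec] using this
  · rintro ⟨htr, hpsd⟩ A hA
    obtain ⟨C, hC⟩ := exists_eq_transpose_mul_self hpsd
    have hJB : Jmat n * B = -(Cᵀ * C) := by rw [← hC, neg_neg]
    have hBt : Bᵀ = -(Cᵀ * C) * Jmat n := by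
      have h := congrArg (fun X => Xᵀ * Jmat n) hJB
      simpa [transpose_mul, Jmat_transpose, Matrix.mul_assoc, Jmat_mul_self] using h
    have hsum := sum_quadratic_nonpos (Jmat n) (Jmat n * A) hA Finset.univ (fun i => C i) (by
      rw [← trace_transpose_mul_self_mul, ← neg_eq_zero, ← trace_neg, ← Matrix.neg_mul, ← hBt,
        trace_transpose, htr])
    rw [← trace_transpose_mul_self_mul] at hsum
    rw [hBt, Matrix.mul_assoc, Matrix.neg_mul, trace_neg]
    linarith
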